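/- arXiv:1109.0635 — 2 statements merged into one kernel-verified Lean document; each statement's English description precedes it below -/
import Mathlib

section
/- Let d ≥ 1, p ∈ [d,∞) and r = p/d. For each n define D_{d,n} : L_{p,π}(μ^d) → L_r(μ) by D_{d,n} f = Σ_{i=1}^{m_n} (1_{A_{i,n}} / μ(A_{i,n})^d) ∫_{A_{i,n}^d} f(x_1,…,x_d) μ(dx_1)⋯μ(dx_d). Then every D_{d,n} has norm at most 1, and D_{d,n} f → D_d f in L_r(μ) for every f ∈ L_{p,π}(μ^d), i.e. D_{d,n} converges to the diagonal restriction operator D_d in the strong operator topology. -/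
open MeasureTheory Filter Topology ENNReal ProbabilityTheory

noncomputable section

namespace VonMises

variable {X : Type} [MeasurableSpace X]

/-- The `d`-fold product measure `μ^d` on the power space `X^d`. -/
abbrev pm (μ : Measure X) (d : ℕ) : Measure (Fin d → X) := Measure.pi fun _ => μ

/-- `(E, tp)` is (a realization of) the projective tensor product
`L_{p 0}(μ) ⊗̂_π ⋯ ⊗̂_π L_{p (d-1)}(μ)`: `tp` is a continuous multilinear map
satisfying the cross-norm identity, whose range spans a dense subspace, and which has
the (isometric) universal lifting property of the projective tensor norm. -/
structure IsPTP (μ : Measure X) {d : ℕ} (p : Fin d → ℝ≥0∞) [∀ i, Fact (1 ≤ p i)]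
    (E : Type) [NormedAddCommGroup E] [NormedSpace ℝ E] [CompleteSpace E]
    (tp : ContinuousMultilinearMap ℝ (fun i : Fin d => Lp ℝ (p i) μ) E) : Prop where
  crossNorm : ∀ f : ∀ i : Fin d, Lp ℝ (p i) μ, ‖tp f‖ = ∏ i, ‖f i‖
  denseSpan : Dense (Submodule.span ℝ (Set.range fun f : ∀ i : Fin d, Lp ℝ (p i) μ => tp f) : Set E)
  lift : ∀ (F : Type) [NormedAddCommGroup F] [NormedSpace ℝ F] [CompleteSpace F]
      (g : ContinuousMultilinearMap ℝ (fun i : Fin d => Lp ℝ (p i) μ) F),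
      ∃ L : E →L[ℝ] F, (∀ f, L (tp f) = g f) ∧ ‖L‖ = ‖g‖

/-- `J` realizes the canonical map from the projective tensor product into `L_q(μ^d)`,
determined by its values on elementary tensors. -/
def IsEmbed (μ : Measure X) {d : ℕ} (p : Fin d → ℝ≥0∞) [∀ i, Fact (1 ≤ p i)]
    (q : ℝ≥0∞) [Fact (1 ≤ q)]
    {E : Type} [NormedAddCommGroup E] [NormedSpace ℝ E] [CompleteSpace E]
    (tp : ContinuousMultilinearMap ℝ (fun i : Fin d => Lp ℝ (p i) μ) E)
    (J : E →L[ℝ] Lp ℝ q (pm μ d)) : Prop :=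
  ∀ f, (J (tp f) : (Fin d → X) → ℝ) =ᵐ[pm μ d] fun x => ∏ i, (f i : X → ℝ) (x i)

/-- `D` realizes the diagonal restriction operator: the norm-one linear map sending an
elementary tensor `f_1 ⊗ ⋯ ⊗ f_d` to the pointwise product `x ↦ f_1(x)⋯f_d(x)`. -/
def IsDiag (μ : Measure X) {d : ℕ} (p : Fin d → ℝ≥0∞) [∀ i, Fact (1 ≤ p i)]
    (r : ℝ≥0∞) [Fact (1 ≤ r)]
    {E : Type} [NormedAddCommGroup E] [NormedSpace ℝ E] [CompleteSpace E]
    (tp : ContinuousMultilinearMap ℝ (fun i : Fin d => Lp ℝ (p i) μ) E)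
    (D : E →L[ℝ] Lp ℝ r μ) : Prop :=
  ‖D‖ = 1 ∧ ∀ f, (D (tp f) : X → ℝ) =ᵐ[μ] fun x => ∏ i, (f i : X → ℝ) x

/-- `W` realizes the tensor Koopman operator `V^𝐤 = V_1^{k_1} ⊗_π ⋯ ⊗_π V_d^{k_d}`,
where `V_i g = g ∘ T_i`. -/
def IsTKoop (μ : Measure X) {d : ℕ} (p : Fin d → ℝ≥0∞) [∀ i, Fact (1 ≤ p i)]
    {E : Type} [NormedAddCommGroup E] [NormedSpace ℝ E] [CompleteSpace E]
    (tp : ContinuousMultilinearMap ℝ (fun i : Fin d => Lp ℝ (p i) μ) E)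
    (T : Fin d → X → X) (k : Fin d → ℕ) (W : E →L[ℝ] E) : Prop :=
  ∀ f g : ∀ i : Fin d, Lp ℝ (p i) μ,
    (∀ i, (g i : X → ℝ) =ᵐ[μ] fun x => (f i : X → ℝ) ((T i)^[k i] x)) → W (tp f) = tp g

/-- `g = V^{*k} f`: the adjoint (transfer) operator applied to `f`, characterized by
`∫_s g dμ = ∫_{T^{-k} s} f dμ` for all measurable `s`. -/
def IsTransfer (μ : Measure X) (T : X → X) (k : ℕ) {p : ℝ≥0∞} [Fact (1 ≤ p)]
    (f g : Lp ℝ p μ) : Prop :=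
  ∀ s : Set X, MeasurableSet s → ∫ x in s, g x ∂μ = ∫ x in T^[k] ⁻¹' s, f x ∂μ

/-- `W` realizes the tensor transfer operator `V^{*𝐤} = V_1^{*k_1} ⊗_π ⋯ ⊗_π V_d^{*k_d}`. -/
def IsTTrans (μ : Measure X) {d : ℕ} (p : Fin d → ℝ≥0∞) [∀ i, Fact (1 ≤ p i)]
    {E : Type} [NormedAddCommGroup E] [NormedSpace ℝ E] [CompleteSpace E]
    (tp : ContinuousMultilinearMap ℝ (fun i : Fin d => Lp ℝ (p i) μ) E)
    (T : Fin d → X → X) (k : Fin d → ℕ) (W : E →L[ℝ] E) : Prop :=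
  ∀ f g : ∀ i : Fin d, Lp ℝ (p i) μ,
    (∀ i, IsTransfer μ (T i) (k i) (f i) (g i)) → W (tp f) = tp g

/-- The σ-algebra of `T`-invariant measurable sets. -/
def invariants (T : X → X) : MeasurableSpace X where
  MeasurableSet' s := MeasurableSet s ∧ T ⁻¹' s = s
  measurableSet_empty := ⟨MeasurableSet.empty, rfl⟩
  measurableSet_compl s hs := ⟨hs.1.compl, by rw [Set.preimage_compl, hs.2]⟩
  measurableSet_iUnion s hs :=
    ⟨MeasurableSet.iUnion fun i => (hs i).1, by
      simp only [Set.preimage_iUnion]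
      exact Set.iUnion_congr fun i => (hs i).2⟩

/-- `W` realizes `E_{inv,1} ⊗_π ⋯ ⊗_π E_{inv,d}`, the projective tensor product of the
conditional expectations with respect to the invariant σ-fields. -/
def IsTCondexpInv (μ : Measure X) {d : ℕ} (p : Fin d → ℝ≥0∞) [∀ i, Fact (1 ≤ p i)]
    {E : Type} [NormedAddCommGroup E] [NormedSpace ℝ E] [CompleteSpace E]
    (tp : ContinuousMultilinearMap ℝ (fun i : Fin d => Lp ℝ (p i) μ) E)
    (T : Fin d → X → X) (W : E →L[ℝ] E) : Prop :=
  ∀ f g : ∀ i : Fin d, Lp ℝ (p i) μ,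
    (∀ i, (g i : X → ℝ) =ᵐ[μ] μ[(f i : X → ℝ) | invariants (T i)]) → W (tp f) = tp g

/-- Exactness of a measure preserving transformation: the tail σ-field
`⋂_n T^{-n}𝓕` is trivial mod `μ`. -/
def Exact (μ : Measure X) (T : X → X) : Prop :=
  ∀ s : Set X, (∀ n : ℕ, ∃ t : Set X, MeasurableSet t ∧ s = T^[n] ⁻¹' t) →
    μ s = 0 ∨ μ s = 1

/-- A kernel of `m` variables is canonical (totally degenerate) if integrating out any
one variable gives `0` almost everywhere. -/
def Canonical (μ : Measure X) (m : ℕ) (h : (Fin m → X) → ℝ) : Prop :=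
  ∀ l : Fin m, ∀ᵐ x ∂ pm μ m, ∫ y, h (Function.update x l y) ∂μ = 0

/-- A kernel of `d` variables is symmetric if it is a.e. invariant under permutations of
its variables. -/
def Symm (μ : Measure X) (d : ℕ) (h : (Fin d → X) → ℝ) : Prop :=
  ∀ σ : Equiv.Perm (Fin d), ∀ᵐ x ∂ pm μ d, h (x ∘ σ) = h x

end VonMises

namespace VonMises

section Aux

variable {X : Type} [mX : MeasurableSpace X]

/-- A step function given by a finite partition with index map `k`. -/
lemma sum_indicator_ae (μ : Measure X) [IsProbabilityMeasure μ] (q : ℝ≥0∞) {m : ℕ}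
    {A : Fin m → Set X} (hmeas : ∀ i, MeasurableSet (A i)) (k : X → Fin m)
    (hk : ∀ x i, x ∈ A i ↔ k x = i) (c : Fin m → ℝ) :
    ((∑ i, indicatorConstLp q (hmeas i) (measure_ne_top μ _) (c i) : Lp ℝ q μ) : X → ℝ)
      =ᵐ[μ] fun x => c (k x) := by
  have h1 := Lp.coeFn_finsetSum Finset.univ
    (fun i => indicatorConstLp q (hmeas i) (measure_ne_top μ _) (c i))
  have h2 : ∀ᵐ x ∂μ, ∀ i, (indicatorConstLp q (hmeas i) (measure_ne_top μ _) (c i) : X → ℝ) x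
      = (A i).indicator (fun _ => c i) x :=
    ae_all_iff.2 fun i => indicatorConstLp_coeFn
  filter_upwards [h1, h2] with x h1 h2
  rw [h1]
  rw [Finset.sum_apply, Finset.sum_congr rfl fun i _ => h2 i, Finset.sum_eq_single (k x)]
  · exact Set.indicator_of_mem ((hk _ _).2 rfl) _
  · exact fun i _ hi => Set.indicator_of_notMem (fun h => hi ((hk _ _).1 h).symm) _
  · exact fun h => absurd (Finset.mem_univ _) h

lemma indicatorConstLp_smul_aux (μ : Measure X) [IsProbabilityMeasure μ] (q : ℝ≥0∞)
    {s : Set X} (hs : MeasurableSet s) (a c : ℝ) :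
    a • (indicatorConstLp q hs (measure_ne_top μ _) c : Lp ℝ q μ)
      = indicatorConstLp q hs (measure_ne_top μ _) (a * c) := by
  refine Lp.ext ?_
  filter_upwards [Lp.coeFn_smul a (indicatorConstLp q hs (measure_ne_top μ _) c : Lp ℝ q μ),
    indicatorConstLp_coeFn (p := q) (hs := hs) (hμs := measure_ne_top μ _) (c := c),
    indicatorConstLp_coeFn (p := q) (hs := hs) (hμs := measure_ne_top μ _) (c := a * c)]
    with x h1 h2 h3
  rw [h1, h3, Pi.smul_apply, h2]
  by_cases hx : x ∈ s <;> simp [hx]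

lemma condExp_comap (μ : Measure X) [IsProbabilityMeasure μ] {m : ℕ}
    {A : Fin m → Set X} (hmeas : ∀ i, MeasurableSet (A i)) (hpos : ∀ i, 0 < μ (A i))
    (k : X → Fin m) (hk : ∀ x i, x ∈ A i ↔ k x = i)
    (hle : MeasurableSpace.comap k ⊤ ≤ mX) (f : X → ℝ) (hf : Integrable f μ) (x : X) :
    (μ[f | MeasurableSpace.comap k ⊤]) x = (∫ y in A (k x), f y ∂μ) / (μ (A (k x))).toReal := by
  have hsm : StronglyMeasurable[MeasurableSpace.comap k ⊤] (μ[f | MeasurableSpace.comap k ⊤]) :=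
    stronglyMeasurable_condExp
  have hconst : ∀ a b, k a = k b →
      (μ[f | MeasurableSpace.comap k ⊤]) a = (μ[f | MeasurableSpace.comap k ⊤]) b := by
    intro a b hab
    obtain ⟨t, -, ht⟩ := hsm.measurable
      (measurableSet_singleton ((μ[f | MeasurableSpace.comap k ⊤]) b))
    have hb : b ∈ k ⁻¹' t := by rw [ht]; rfl
    have ha : a ∈ k ⁻¹' t := by simpa [Set.mem_preimage, hab] using hb
    rw [ht] at ha
    exact ha
  have hs : MeasurableSet[MeasurableSpace.comap k ⊤] (A (k x)) :=
    ⟨{k x}, trivial, by ext y; simp [hk]⟩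
  have h := setIntegral_condExp hle hf hs
  have h2 : ∫ y in A (k x), (μ[f | MeasurableSpace.comap k ⊤]) y ∂μ
      = ∫ y in A (k x), (μ[f | MeasurableSpace.comap k ⊤]) x ∂μ :=
    setIntegral_congr_fun (hmeas _) fun y hy => hconst y x ((hk _ _).1 hy)
  rw [h2, setIntegral_const, smul_eq_mul] at h
  rw [← h, Measure.real]
  have : (μ (A (k x))).toReal ≠ 0 := (ENNReal.toReal_pos (hpos _).ne' (measure_ne_top _ _)).ne'
  field_simp

lemma tendsto_condExp_bdd (μ : Measure X) [IsProbabilityMeasure μ] (p : ℝ≥0∞) (hp1 : 1 ≤ p)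
    (hp : p ≠ ∞) (ℱ : Filtration ℕ mX) (hℱ : ⨆ n, ℱ n = mX) (g : X → ℝ)
    (hg : StronglyMeasurable g) (R : ℝ) (hR : ∀ x, |g x| ≤ R) :
    Tendsto (fun n => eLpNorm (μ[g | ℱ n] - g) p μ) atTop (𝓝 0) := by
  have hgp : ∀ q, MemLp g q μ := fun q =>
    MemLp.of_bound hg.aestronglyMeasurable R (Eventually.of_forall hR)
  have hgi : Integrable g μ := (hgp 1).integrable le_rfl
  refine tendsto_Lp_finite_of_tendsto_ae hp1 hp
    (fun n => (stronglyMeasurable_condExp.mono (ℱ.le n)).aestronglyMeasurable) (hgp p) ?_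
    (hgi.tendsto_ae_condExp (by rw [hℱ]; exact hg))
  refine unifIntegrable_of hp1 hp
    (fun n => (stronglyMeasurable_condExp.mono (ℱ.le n)).aestronglyMeasurable) fun ε hε =>
    ⟨(R.toNNReal + 1), fun n => ?_⟩
  have hb : ∀ᵐ x ∂μ, ‖(μ[g | ℱ n]) x‖ ≤ R.toNNReal :=
    ae_bdd_norm_condExp_of_ae_bdd_norm (R := R.toNNReal)
      (Eventually.of_forall fun x => (hR x).trans (Real.le_coe_toNNReal R))
  have : ({x | R.toNNReal + 1 ≤ ‖(μ[g | ℱ n]) x‖₊}.indicator (μ[g | ℱ n])) =ᵐ[μ] 0 := by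
    filter_upwards [hb] with x hx
    refine Set.indicator_of_notMem (fun h => ?_) _
    have h' : (R.toNNReal : ℝ) + 1 ≤ ‖(μ[g | ℱ n]) x‖ := by exact_mod_cast h
    linarith
  rw [eLpNorm_congr_ae this]
  simp

lemma tendsto_condExp_Lp (μ : Measure X) [IsProbabilityMeasure μ] (p : ℝ≥0∞) (hp1 : 1 ≤ p)
    (hp : p ≠ ∞) (ℱ : Filtration ℕ mX) (hℱ : ⨆ n, ℱ n = mX) (f : X → ℝ) (hf : MemLp f p μ) :
    Tendsto (fun n => eLpNorm (μ[f | ℱ n] - f) p μ) atTop (𝓝 0) := by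
  rw [ENNReal.tendsto_atTop_zero]
  intro ε hε
  have hε3 : ε / 3 ≠ 0 := (ENNReal.div_pos hε.ne' (by simp)).ne'
  obtain ⟨g, hg, hgp⟩ := hf.exists_simpleFunc_eLpNorm_sub_lt hp hε3
  obtain ⟨R, hR⟩ := g.exists_forall_norm_le
  obtain ⟨N, hN⟩ := ENNReal.tendsto_atTop_zero.1
    (tendsto_condExp_bdd μ p hp1 hp ℱ hℱ g g.stronglyMeasurable R hR) (ε / 3)
    (pos_iff_ne_zero.2 hε3)
  refine ⟨N, fun n hn => ?_⟩
  have hfi := hf.integrable hp1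
  have hgi := hgp.integrable hp1
  have e : (μ[f | ℱ n] - f) =ᵐ[μ] (μ[f - ⇑g | ℱ n] + (μ[⇑g | ℱ n] - ⇑g)) + (⇑g - f) := by
    filter_upwards [condExp_sub hfi hgi (ℱ n)] with x hx
    simp only [Pi.sub_apply, Pi.add_apply] at hx ⊢
    rw [hx]; ring
  have m1 : AEStronglyMeasurable (μ[f - ⇑g | ℱ n]) μ :=
    (stronglyMeasurable_condExp.mono (ℱ.le n)).aestronglyMeasurable
  have m2 : AEStronglyMeasurable (μ[⇑g | ℱ n]) μ :=
    (stronglyMeasurable_condExp.mono (ℱ.le n)).aestronglyMeasurable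
  have m3 : AEStronglyMeasurable (⇑g) μ := hgp.1
  rw [eLpNorm_congr_ae e]
  calc _ ≤ eLpNorm (μ[f - ⇑g | ℱ n] + (μ[⇑g | ℱ n] - ⇑g)) p μ + eLpNorm (⇑g - f) p μ :=
        eLpNorm_add_le (m1.add (m2.sub m3)) (m3.sub hf.1) hp1
    _ ≤ (eLpNorm (μ[f - ⇑g | ℱ n]) p μ + eLpNorm (μ[⇑g | ℱ n] - ⇑g) p μ)
        + eLpNorm (⇑g - f) p μ := by
        gcongr
        exact eLpNorm_add_le m1 (m2.sub m3) hp1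
    _ ≤ (ε / 3 + ε / 3) + ε / 3 := by
        gcongr
        · exact (eLpNorm_condExp_le_eLpNorm _ hp1).trans hg.le
        · exact hN n hn
        · rw [eLpNorm_sub_comm]; exact hg.le
    _ = ε := ENNReal.add_thirds ε

/-- Integration over a set as a continuous linear functional on `L_p`. -/
lemma exists_setIntegralCLM {Y : Type} [MeasurableSpace Y] (ν : Measure Y)
    [IsProbabilityMeasure ν] (p : ℝ≥0∞) [hp : Fact (1 ≤ p)] (S : Set Y) :
    ∃ φ : Lp ℝ p ν →L[ℝ] ℝ, ∀ f : Lp ℝ p ν, φ f = ∫ y in S, f y ∂ν := by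
  have hint : ∀ f : Lp ℝ p ν, Integrable (f : Y → ℝ) ν := fun f => (Lp.memLp f).integrable hp.out
  refine ⟨LinearMap.mkContinuous
    { toFun := fun f => ∫ y in S, f y ∂ν
      map_add' := fun f g => ?_
      map_smul' := fun c f => ?_ } 1 fun f => ?_, fun f => rfl⟩
  · rw [← integral_add (hint f).integrableOn (hint g).integrableOn]
    exact integral_congr_ae (ae_restrict_of_ae (Lp.coeFn_add f g))
  · rw [RingHom.id_apply, smul_eq_mul, ← integral_const_mul]
    exact integral_congr_ae (ae_restrict_of_ae (Lp.coeFn_smul c f))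
  · rw [one_mul]
    change ‖∫ y in S, f y ∂ν‖ ≤ ‖f‖
    calc ‖∫ y in S, f y ∂ν‖ ≤ ∫ y in S, ‖f y‖ ∂ν := norm_integral_le_integral_norm _
      _ ≤ ∫ y, ‖f y‖ ∂ν :=
        setIntegral_le_integral (hint f).norm (Eventually.of_forall fun _ => norm_nonneg _)
      _ = (eLpNorm f 1 ν).toReal := by
        rw [integral_norm_eq_lintegral_enorm (hint f).1, eLpNorm_one_eq_lintegral_enorm]
      _ ≤ (eLpNorm f p ν).toReal :=
        ENNReal.toReal_mono (Lp.eLpNorm_ne_top f)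
          (eLpNorm_le_eLpNorm_of_exponent_le hp.out (hint f).1)
      _ = ‖f‖ := (Lp.norm_def f).symm

end Aux

/-- Proposition 2: the conditional-expectation approximations
`D_{d,n} f = Σ_i 1_{A_{i,n}}/μ(A_{i,n})^d ∫_{A_{i,n}^d} f dμ^d` all have norm at most one
as operators from `L_{p,π}(μ^d)` to `L_r(μ)`, and converge strongly to the diagonal
restriction operator `D_d`. -/
theorem statement2
    {X : Type} [MeasurableSpace X] [StandardBorelSpace X]
    (μ : Measure X) [IsProbabilityMeasure μ]
    (d : ℕ) (hd : 1 ≤ d) (p r : ℝ≥0∞) [Fact (1 ≤ p)] [Fact (1 ≤ r)]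
    (hp : (d : ℝ≥0∞) ≤ p) (hp' : p ≠ ∞) (hr : r = p / d)
    (E : Type) [NormedAddCommGroup E] [NormedSpace ℝ E] [CompleteSpace E]
    (tp : ContinuousMultilinearMap ℝ (fun _ : Fin d => Lp ℝ p μ) E)
    (hE : IsPTP μ (fun _ : Fin d => p) E tp)
    (J : E →L[ℝ] Lp ℝ p (pm μ d)) (hJ : IsEmbed μ (fun _ : Fin d => p) p tp J)
    (D : E →L[ℝ] Lp ℝ r μ) (hD : IsDiag μ (fun _ : Fin d => p) r tp D)
    -- a refining sequence of finite measurable partitions of `X` generating `𝓕`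
    (m : ℕ → ℕ) (A : (n : ℕ) → Fin (m n) → Set X)
    (hmeas : ∀ n i, MeasurableSet (A n i))
    (hpos : ∀ n i, 0 < μ (A n i))
    (hdisj : ∀ n, ∀ i j : Fin (m n), i ≠ j → Disjoint (A n i) (A n j))
    (hcover : ∀ n, (⋃ i, A n i) = Set.univ)
    (hrefine : ∀ n i, ∃ j, A (n + 1) i ⊆ A n j)
    (hgen : (⨆ n, MeasurableSpace.generateFrom (Set.range (A n))) = ‹MeasurableSpace X›) :
    ∀ f : E,
      (∀ n, ‖(∑ i : Fin (m n), indicatorConstLp r (hmeas n i) (measure_ne_top μ _)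
            ((∫ x in Set.univ.pi fun _ : Fin d => A n i, (J f) x ∂ pm μ d) /
              (μ (A n i)).toReal ^ d) : Lp ℝ r μ)‖ ≤ ‖f‖) ∧
      Tendsto (fun n => (∑ i : Fin (m n), indicatorConstLp r (hmeas n i) (measure_ne_top μ _)
            ((∫ x in Set.univ.pi fun _ : Fin d => A n i, (J f) x ∂ pm μ d) /
              (μ (A n i)).toReal ^ d) : Lp ℝ r μ))
        atTop (𝓝 (D f)) := by
  classical
  -- index maps
  have hex : ∀ n x, ∃ i, x ∈ A n i := fun n x => by
    have : x ∈ ⋃ i, A n i := by rw [hcover]; trivial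
    simpa using this
  choose k hkmem using hex
  have hk : ∀ n x i, x ∈ A n i ↔ k n x = i := by
    intro n x i
    refine ⟨fun h => ?_, fun h => h ▸ hkmem n x⟩
    by_contra hne
    exact Set.disjoint_left.1 (hdisj n _ _ hne) (hkmem n x) h
  have hpre : ∀ n i, k n ⁻¹' {i} = A n i := fun n i => by ext x; simp [hk]
  have hkm : ∀ n, Measurable[_, ⊤] (k n) := fun n => by
    refine @measurable_to_countable' _ _ ⊤ _ _ _ fun i => ?_
    rw [hpre]; exact hmeas n i
  have hle : ∀ n, MeasurableSpace.comap (k n) ⊤ ≤ ‹MeasurableSpace X› :=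
    fun n => (hkm n).comap_le
  choose j hj using hrefine
  have hkj : ∀ n x, k n x = j n (k (n + 1) x) := fun n x =>
    (hk n x _).1 (hj n _ (hkmem (n + 1) x))
  let ℱ : Filtration ℕ ‹MeasurableSpace X› :=
    { seq := fun n => MeasurableSpace.comap (k n) ⊤
      mono' := monotone_nat_of_le_succ fun n => by
        rintro s ⟨t, -, rfl⟩
        exact ⟨j n ⁻¹' t, trivial, by ext x; simp [hkj n x]⟩
      le' := hle }
  have hℱ : ⨆ n, ℱ n = ‹MeasurableSpace X› := by
    refine le_antisymm (iSup_le hle) ?_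
    conv_lhs => rw [← hgen]
    refine iSup_mono fun n => MeasurableSpace.generateFrom_le ?_
    rintro s ⟨i, rfl⟩
    exact ⟨{i}, trivial, hpre n i⟩
  have hp1 : 1 ≤ p := Fact.out
  -- the averaging operators
  let e : ℕ → Lp ℝ p μ → Lp ℝ p μ := fun n f =>
    ∑ i : Fin (m n), indicatorConstLp p (hmeas n i) (measure_ne_top μ _)
      ((∫ x in A n i, f x ∂μ) / (μ (A n i)).toReal)
  have he : ∀ n (f : Lp ℝ p μ), (e n f : X → ℝ) =ᵐ[μ]
      fun x => (∫ y in A n (k n x), f y ∂μ) / (μ (A n (k n x))).toReal := fun n f =>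
    sum_indicator_ae μ p (hmeas n) (k n) (hk n) _
  have hec : ∀ n (f : Lp ℝ p μ), (e n f : X → ℝ) =ᵐ[μ] μ[(f : X → ℝ) | ℱ n] := fun n f => by
    refine (he n f).trans (Eventually.of_forall fun x => ?_)
    exact (condExp_comap μ (hmeas n) (hpos n) (k n) (hk n) (hle n) f
      ((Lp.memLp f).integrable hp1) x).symm
  have henorm : ∀ n f, ‖e n f‖ ≤ ‖f‖ := fun n f => by
    rw [Lp.norm_def, Lp.norm_def]
    refine ENNReal.toReal_mono (Lp.eLpNorm_ne_top f) ?_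
    rw [eLpNorm_congr_ae (hec n f)]
    exact eLpNorm_condExp_le_eLpNorm _ hp1
  have hetend : ∀ f, Tendsto (fun n => e n f) atTop (𝓝 f) := fun f => by
    rw [Lp.tendsto_Lp_iff_tendsto_eLpNorm']
    refine (tendsto_condExp_Lp μ p hp1 hp' ℱ hℱ f (Lp.memLp f)).congr fun n => ?_
    exact eLpNorm_congr_ae ((hec n f).symm.sub (EventuallyEq.refl _ _))
  -- the operators `D_{d,n}` as continuous linear maps
  choose φ hφ using fun n (i : Fin (m n)) =>
    exists_setIntegralCLM (pm μ d) p (Set.univ.pi fun _ : Fin d => A n i)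
  let Dn : ℕ → E →L[ℝ] Lp ℝ r μ := fun n =>
    ∑ i : Fin (m n), (((φ n i).comp J).smulRight
      (indicatorConstLp r (hmeas n i) (measure_ne_top μ _) ((μ (A n i)).toReal ^ d)⁻¹))
  have hDn : ∀ n f, (∑ i : Fin (m n), indicatorConstLp r (hmeas n i) (measure_ne_top μ _)
            ((∫ x in Set.univ.pi fun _ : Fin d => A n i, (J f) x ∂ pm μ d) /
              (μ (A n i)).toReal ^ d) : Lp ℝ r μ) = Dn n f := by
    intro n f
    simp only [Dn, sum_apply, ContinuousLinearMap.smulRight_apply,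
      ContinuousLinearMap.comp_apply, hφ]
    refine Finset.sum_congr rfl fun i _ => ?_
    rw [indicatorConstLp_smul_aux, div_eq_mul_inv]
  have hDntp : ∀ n f, Dn n (tp f) = D (tp fun l => e n (f l)) := by
    intro n f
    rw [← hDn]
    refine Lp.ext ?_
    have h3 : ∀ᵐ x ∂μ, ∀ l, (e n (f l) : X → ℝ) x =
        (∫ y in A n (k n x), f l y ∂μ) / (μ (A n (k n x))).toReal :=
      ae_all_iff.2 fun l => he n (f l)
    filter_upwards [sum_indicator_ae μ r (hmeas n) (k n) (hk n) (fun i =>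
      (∫ x in Set.univ.pi fun _ : Fin d => A n i, (J (tp f)) x ∂ pm μ d) /
              (μ (A n i)).toReal ^ d), hD.2 (fun l => e n (f l)), h3] with x h1 h2 h3
    rw [h1, h2]
    simp only [h3]
    rw [Finset.prod_div_distrib, Finset.prod_const, Finset.card_univ, Fintype.card_fin]
    congr 1
    rw [integral_congr_ae (ae_restrict_of_ae (hJ f)), Measure.restrict_pi_pi]
    exact integral_fintype_prod_eq_prod (fun l => (f l : X → ℝ))
  have hDnorm : ∀ n, ‖Dn n‖ ≤ 1 := by
    intro n
    let g := (Dn n).compContinuousMultilinearMap tp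
    obtain ⟨L, hL, hLn⟩ := hE.lift (Lp ℝ r μ) g
    have hLD : L = Dn n := by
      refine ContinuousLinearMap.ext_on hE.denseSpan ?_
      rintro _ ⟨f, rfl⟩
      exact hL f
    rw [← hLD, hLn]
    refine ContinuousMultilinearMap.opNorm_le_bound zero_le_one fun f => ?_
    rw [one_mul]
    change ‖Dn n (tp f)‖ ≤ _
    rw [hDntp]
    calc _ ≤ ‖D‖ * ‖tp fun l => e n (f l)‖ := D.le_opNorm _
      _ = ∏ l, ‖e n (f l)‖ := by rw [hD.1, one_mul, hE.crossNorm]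
      _ ≤ ∏ l, ‖f l‖ := Finset.prod_le_prod (fun _ _ => norm_nonneg _) fun l _ => henorm n (f l)
  have hbound : ∀ n f, ‖Dn n f‖ ≤ ‖f‖ := fun n f => by
    simpa using (Dn n).le_of_opNorm_le (hDnorm n) f
  intro f
  simp only [hDn]
  refine ⟨fun n => hbound n f, ?_⟩
  -- convergence on the span
  have hspan : ∀ g ∈ Submodule.span ℝ (Set.range fun f : Fin d → Lp ℝ p μ => tp f),
      Tendsto (fun n => Dn n g) atTop (𝓝 (D g)) := by
    intro g hg
    induction hg using Submodule.span_induction with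
    | mem x hx =>
      obtain ⟨f, rfl⟩ := hx
      simp only [hDntp]
      exact ((D.continuous.comp tp.cont).tendsto f).comp
        (tendsto_pi_nhds.2 fun l => hetend (f l))
    | zero => simp
    | add x y _ _ hx hy => simpa using hx.add hy
    | smul c x _ hx => simpa using hx.const_smul c
  rw [Metric.tendsto_atTop]
  intro ε hε
  obtain ⟨g, hg, hfg⟩ := Metric.mem_closure_iff.1 (hE.denseSpan f) (ε / 3) (by positivity)
  obtain ⟨N, hN⟩ := Metric.tendsto_atTop.1 (hspan g hg) (ε / 3) (by positivity)
  refine ⟨N, fun n hn => ?_⟩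
  have h1 : dist (Dn n f) (Dn n g) ≤ dist f g := by
    rw [dist_eq_norm, dist_eq_norm, ← map_sub]; exact hbound n _
  have h2 : dist (D g) (D f) ≤ dist f g := by
    rw [dist_comm f g, dist_eq_norm, dist_eq_norm, ← map_sub]
    simpa [hD.1] using D.le_opNorm (g - f)
  have h3 := hN n hn
  have := dist_triangle4 (Dn n f) (Dn n g) (D g) (D f)
  linarith

end VonMises
end
end

section
/- Let p = rd for some integer d ≥ 1 and real r ∈ [1,∞). Let T_1,…,T_d be measure preserving transformations of the probability space (X,𝓕,μ) and f ∈ L_{p,π}(μ^d). Then, as n_1,…,n_d → ∞, (1/(n_1⋯n_d)) Σ_{0 ≤ k_1 < n_1,…,0 ≤ k_d < n_d} D_d V^{(k_1,…,k_d)} f converges μ-almost surely and in L_r(μ) to D_d (E_{inv,1} ⊗_π ⋯ ⊗_π E_{inv,d}) f. -/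
open MeasureTheory Filter Topology ENNReal ProbabilityTheory

noncomputable section

namespace VonMises

/-! ### Maximal ergodic theorem -/

/-- running maximum of Birkhoff sums -/
def bmax {X : Type} (T : X → X) (h : X → ℝ) (N : ℕ) (x : X) : ℝ :=
  (Finset.range (N + 1)).sup' Finset.nonempty_range_add_one (fun n => birkhoffSum T h n x)

lemma measurable_bsum {X : Type} [MeasurableSpace X] {T : X → X} (hT : Measurable T) {h : X → ℝ}
    (hh : Measurable h) (n : ℕ) : Measurable (birkhoffSum T h n) := by
  unfold birkhoffSum
  exact Finset.measurable_fun_sum _ fun k _ => hh.comp (hT.iterate k)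

lemma integrable_bsum {X : Type} [MeasurableSpace X] {μ : Measure X} {T : X → X}
    (hT : MeasurePreserving T μ μ) {h : X → ℝ}
    (hi : Integrable h μ) (n : ℕ) : Integrable (birkhoffSum T h n) μ := by
  unfold birkhoffSum
  exact integrable_finsetSum _ fun k _ => (hT.iterate k).integrable_comp_of_integrable hi

lemma measurable_bmax {X : Type} [MeasurableSpace X] {T : X → X} (hT : Measurable T) {h : X → ℝ}
    (hh : Measurable h) (N : ℕ) : Measurable (bmax T h N) := by
  have := Finset.measurable_sup' (s := Finset.range (N+1)) Finset.nonempty_range_add_one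
    (f := fun n => birkhoffSum T h n) (fun n _ => measurable_bsum hT hh n)
  convert this using 1
  ext x
  simp [bmax, Finset.sup'_apply]

lemma bmax_nonneg {X : Type} (T : X → X) (h : X → ℝ) (N : ℕ) (x : X) : 0 ≤ bmax T h N x := by
  have := Finset.le_sup' (f := fun n => birkhoffSum T h n x) (b := 0) (s := Finset.range (N+1))
    (by simp)
  rw [birkhoffSum_zero] at this
  exact this

lemma le_bmax {X : Type} (T : X → X) (h : X → ℝ) (N : ℕ) (x : X) {n : ℕ} (hn : n ≤ N) :
    birkhoffSum T h n x ≤ bmax T h N x :=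
  Finset.le_sup' (f := fun n => birkhoffSum T h n x) (s := Finset.range (N+1))
    (by simp; omega)

lemma integrable_bmax {X : Type} [MeasurableSpace X] {μ : Measure X} {T : X → X}
    (hT : MeasurePreserving T μ μ) {h : X → ℝ} (hh : Measurable h)
    (hi : Integrable h μ) (N : ℕ) : Integrable (bmax T h N) μ := by
  refine Integrable.mono' (g := fun x => ∑ n ∈ Finset.range (N+1), |birkhoffSum T h n x|)
    (integrable_finsetSum _ fun n _ => (integrable_bsum hT hi n).abs)
    (measurable_bmax hT.measurable hh N).aestronglyMeasurable (Eventually.of_forall fun x => ?_)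
  rw [Real.norm_of_nonneg (bmax_nonneg _ _ _ _)]
  refine Finset.sup'_le _ _ fun n hn => (le_abs_self _).trans ?_
  exact Finset.single_le_sum (f := fun n => |birkhoffSum T h n x|) (fun _ _ => abs_nonneg _) hn

lemma maximal_ergodic {X : Type} [MeasurableSpace X] {μ : Measure X} {T : X → X}
    (hT : MeasurePreserving T μ μ) {h : X → ℝ} (hh : Measurable h)
    (hi : Integrable h μ) (N : ℕ) : 0 ≤ ∫ x in {x | 0 < bmax T h N x}, h x ∂μ := by
  have hA : MeasurableSet {x | 0 < bmax T h N x} :=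
    measurableSet_lt measurable_const (measurable_bmax hT.measurable hh N)
  have hb := integrable_bmax hT hh hi N
  have hbT := hT.integrable_comp_of_integrable hb
  rw [← integral_indicator hA]
  have h0 : ∫ x, (bmax T h N x - bmax T h N (T x)) ∂μ = 0 := by
    refine (integral_sub hb hbT).trans ?_
    rw [sub_eq_zero]
    have := integral_map (μ := μ) hT.measurable.aemeasurable (f := bmax T h N)
      (measurable_bmax hT.measurable hh N).aestronglyMeasurable
    rw [hT.map_eq] at this
    exact this
  refine h0.symm.le.trans ?_
  refine integral_mono (hb.sub hbT) (hi.indicator hA) fun x => ?_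
  by_cases hx : 0 < bmax T h N x
  · rw [Set.indicator_of_mem (by exact hx)]
    obtain ⟨n, hn, hne⟩ := Finset.exists_mem_eq_sup' (s := Finset.range (N+1))
      Finset.nonempty_range_add_one (fun n => birkhoffSum T h n x)
    change bmax T h N x = birkhoffSum T h n x at hne
    change bmax T h N x - bmax T h N (T x) ≤ h x
    rcases n with _ | n
    · rw [birkhoffSum_zero] at hne; linarith
    · rw [birkhoffSum_succ'] at hne
      have := le_bmax T h N (T x) (n := n) (by simp at hn; omega)
      linarith
  · rw [Set.indicator_of_notMem (by exact hx)]
    have := bmax_nonneg T h N (T x)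
    change bmax T h N x - bmax T h N (T x) ≤ 0
    linarith

lemma birkhoff_upper {X : Type} [MeasurableSpace X] {μ : Measure X} [IsFiniteMeasure μ] {T : X → X}
    (hT : MeasurePreserving T μ μ) {f c : X → ℝ} (hf : Measurable f) (hc : Measurable c)
    (hfi : Integrable f μ) (hci : Integrable c μ) (hcT : ∀ x, c (T x) = c x)
    (hfc : ∀ s, MeasurableSet s → T ⁻¹' s = s → ∫ x in s, f x ∂μ = ∫ x in s, c x ∂μ)
    {ε : ℝ} (hε : 0 < ε) :
    ∀ᵐ x ∂μ, ∃ C : ℝ, ∀ n : ℕ, birkhoffSum T f n x ≤ n * c x + n * ε + C := by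
  set h : X → ℝ := fun x => f x - c x - ε with hh
  have hhm : Measurable h := (hf.sub hc).sub measurable_const
  have hhi : Integrable h μ := (hfi.sub hci).sub (integrable_const _)
  have hsum : ∀ n x, birkhoffSum T h n x = birkhoffSum T f n x - n * c x - n * ε := by
    intro n x
    have hk : ∀ k, c (T^[k] x) = c x := by
      intro k
      induction k with
      | zero => rfl
      | succ k ih => rw [Function.iterate_succ_apply', hcT, ih]
    simp [birkhoffSum, hh, Finset.sum_sub_distrib, hk]
  set F : Set X := {x | ¬ BddAbove (Set.range fun n => birkhoffSum T h n x)} with hF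
  have hFm : MeasurableSet F :=
    (measurableSet_bddAbove_range fun n => measurable_bsum hT.measurable hhm n).compl
  have hFT : T ⁻¹' F = F := by
    ext x
    simp only [hF, Set.mem_preimage, Set.mem_ofPred_eq, not_iff_not]
    constructor
    · rintro ⟨C, hC⟩
      refine ⟨max 0 (h x + C), ?_⟩
      rintro _ ⟨n, rfl⟩
      rcases n with _ | n
      · simp
      · simp only [birkhoffSum_succ']
        have := hC ⟨n, rfl⟩
        exact le_max_of_le_right (by simpa using this)
    · rintro ⟨C, hC⟩
      refine ⟨C - h x, ?_⟩
      rintro _ ⟨n, rfl⟩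
      have := hC ⟨n+1, rfl⟩
      simp only [birkhoffSum_succ'] at this
      simp only; linarith
  have hTF : MeasurePreserving T (μ.restrict F) (μ.restrict F) := by
    have := hT.restrict_preimage hFm
    rwa [hFT] at this
  have hpos : ∀ N, 0 ≤ ∫ x in {x | 0 < bmax T h N x}, h x ∂(μ.restrict F) :=
    fun N => maximal_ergodic hTF hhm hhi.restrict N
  have hlim : Tendsto (fun N => ∫ x in {x | 0 < bmax T h N x}, h x ∂(μ.restrict F)) atTop
      (𝓝 (∫ x in ⋃ N, {x | 0 < bmax T h N x}, h x ∂(μ.restrict F))) := by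
    refine tendsto_setIntegral_of_monotone (fun N => measurableSet_lt measurable_const
      (measurable_bmax hT.measurable hhm N)) ?_ hhi.restrict.integrableOn
    intro N M hNM x hx
    have hx' : 0 < bmax T h N x := hx
    refine lt_of_lt_of_le hx' ?_
    exact Finset.sup'_mono _ (by simpa using hNM) _
  have hge := ge_of_tendsto' hlim hpos
  have hU : F ⊆ ⋃ N, {x | 0 < bmax T h N x} := by
    intro x hx
    by_contra hcon
    apply hx
    refine ⟨0, ?_⟩
    rintro _ ⟨n, rfl⟩
    simp only [Set.mem_iUnion, not_exists, Set.mem_ofPred_eq, not_lt] at hcon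
    exact (le_bmax T h n x le_rfl).trans (hcon n)
  rw [Measure.restrict_restrict (MeasurableSet.iUnion fun N => measurableSet_lt measurable_const
      (measurable_bmax hT.measurable hhm N)), Set.inter_eq_right.2 hU] at hge
  have hval : ∫ x in F, h x ∂μ = - (μ.real F * ε) := by
    simp only [hh]
    refine (integral_sub (hfi.sub hci).restrict (integrable_const _)).trans ?_
    simp only [Pi.sub_apply]
    rw [integral_sub hfi.restrict hci.restrict,
      hfc F hFm hFT]
    simp
  have h0 : μ F = 0 := by
    have h1 : μ.real F ≤ 0 := by
      by_contra hlt
      push Not at hlt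
      have := mul_pos hlt hε
      linarith
    have := le_antisymm h1 measureReal_nonneg
    exact (measureReal_eq_zero_iff).1 this
  have : ∀ᵐ x ∂μ, x ∉ F := measure_eq_zero_iff_ae_notMem.1 h0
  filter_upwards [this] with x hx
  simp only [hF, Set.mem_ofPred_eq, not_not] at hx
  obtain ⟨C, hC⟩ := hx
  refine ⟨C, fun n => ?_⟩
  have := hC ⟨n, rfl⟩
  simp only [hsum] at this
  linarith

lemma birkhoff_ae {X : Type} [MeasurableSpace X] {μ : Measure X} [IsFiniteMeasure μ] {T : X → X}
    (hT : MeasurePreserving T μ μ) {f c : X → ℝ} (hf : Measurable f) (hc : Measurable c)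
    (hfi : Integrable f μ) (hci : Integrable c μ) (hcT : ∀ x, c (T x) = c x)
    (hfc : ∀ s, MeasurableSet s → T ⁻¹' s = s → ∫ x in s, f x ∂μ = ∫ x in s, c x ∂μ) :
    ∀ᵐ x ∂μ, Tendsto (fun n : ℕ => (n : ℝ)⁻¹ * birkhoffSum T f n x) atTop (𝓝 (c x)) := by
  have h1 : ∀ᵐ x ∂μ, ∀ k : ℕ, ∃ C : ℝ, ∀ n : ℕ,
      birkhoffSum T f n x ≤ n * c x + n * (1 / ((k : ℝ) + 1)) + C := by
    rw [ae_all_iff]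
    exact fun k => birkhoff_upper hT hf hc hfi hci hcT hfc (by positivity)
  have h2 : ∀ᵐ x ∂μ, ∀ k : ℕ, ∃ C : ℝ, ∀ n : ℕ,
      birkhoffSum T (-f) n x ≤ n * (-c) x + n * (1 / ((k : ℝ) + 1)) + C := by
    rw [ae_all_iff]
    refine fun k => birkhoff_upper hT hf.neg hc.neg hfi.neg hci.neg (fun x => by simp [hcT]) ?_
      (by positivity)
    intro s hs hs'
    simp only [Pi.neg_apply]
    rw [integral_neg, integral_neg, hfc s hs hs']
  filter_upwards [h1, h2] with x hx1 hx2
  rw [Metric.tendsto_atTop]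
  intro ε hε
  obtain ⟨k, hk⟩ := exists_nat_one_div_lt (half_pos hε)
  obtain ⟨C1, hC1⟩ := hx1 k
  obtain ⟨C2, hC2⟩ := hx2 k
  obtain ⟨N, hN⟩ := exists_nat_gt ((|C1| + |C2|) / (ε / 2))
  refine ⟨N + 1, fun n hn => ?_⟩
  have hn0 : (0 : ℝ) < n := by exact_mod_cast (by omega : 0 < n)
  have hnN : (N : ℝ) ≤ n := by exact_mod_cast (by omega : N ≤ n)
  rw [div_lt_iff₀ (half_pos hε)] at hN
  have hb : |C1| + |C2| < n * (ε / 2) := hN.trans_le (by gcongr)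
  have a1 := hC1 n
  have a2 := hC2 n
  rw [birkhoffSum_neg, Pi.neg_apply] at a2
  have hk' : n * (1 / ((k : ℝ) + 1)) < n * (ε / 2) := by gcongr
  rw [Real.dist_eq]
  have e : (n : ℝ)⁻¹ * birkhoffSum T f n x - c x = (birkhoffSum T f n x - n * c x) / n := by
    field_simp
  rw [e, abs_div, abs_of_pos hn0, div_lt_iff₀ hn0, abs_lt]
  have := le_abs_self C1
  have := le_abs_self C2
  have := abs_nonneg C1
  have := abs_nonneg C2
  constructor <;> nlinarith

/-- maximal function of averages -/
def mavg {X : Type} (T : X → X) (f : X → ℝ) (N : ℕ) (x : X) : ℝ :=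
  (Finset.range (N + 1)).sup' Finset.nonempty_range_add_one
    (fun n => (n : ℝ)⁻¹ * birkhoffSum T (fun y => |f y|) n x)

lemma measurable_mavg {X : Type} [MeasurableSpace X] {T : X → X} (hT : Measurable T) {f : X → ℝ}
    (hf : Measurable f) (N : ℕ) : Measurable (mavg T f N) := by
  have := Finset.measurable_sup' (s := Finset.range (N+1)) Finset.nonempty_range_add_one
    (f := fun n => fun x => (n : ℝ)⁻¹ * birkhoffSum T (fun y => |f y|) n x)
    (fun n _ => (measurable_bsum hT (measurable_norm.comp hf) n).const_mul _)
  convert this using 1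
  ext x
  simp [mavg, Finset.sup'_apply]

lemma mavg_nonneg {X : Type} (T : X → X) (f : X → ℝ) (N : ℕ) (x : X) : 0 ≤ mavg T f N x := by
  have := Finset.le_sup' (f := fun n : ℕ => (n : ℝ)⁻¹ * birkhoffSum T (fun y => |f y|) n x)
    (b := 0) (s := Finset.range (N+1)) (by simp)
  rw [birkhoffSum_zero, mul_zero] at this
  exact this

lemma avg_le_mavg {X : Type} (T : X → X) (f : X → ℝ) (N : ℕ) (x : X) {n : ℕ} (hn : n ≤ N) :
    |(n : ℝ)⁻¹ * birkhoffSum T f n x| ≤ mavg T f N x := by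
  refine le_trans ?_ (Finset.le_sup'
    (f := fun n : ℕ => (n : ℝ)⁻¹ * birkhoffSum T (fun y => |f y|) n x) (b := n)
    (s := Finset.range (N+1)) (by simp; omega))
  rw [abs_mul, abs_of_nonneg (by positivity : (0 : ℝ) ≤ (n : ℝ)⁻¹)]
  gcongr
  exact Finset.abs_sum_le_sum_abs _ _

lemma mavg_weak {X : Type} [MeasurableSpace X] {μ : Measure X} [IsFiniteMeasure μ] {T : X → X}
    (hT : MeasurePreserving T μ μ) {f : X → ℝ} (hf : Measurable f) (hfi : Integrable f μ)
    (N : ℕ) {t : ℝ} (ht : 0 < t) :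
    μ {x | t < mavg T f N x} * ENNReal.ofReal t ≤
      2 * (μ.withDensity fun x => ENNReal.ofReal |f x|) {x | t < 2 * |f x|} := by
  set h : X → ℝ := fun x => |f x| - t with hh
  have hfa : Measurable fun x => |f x| := measurable_norm.comp hf
  have hhm : Measurable h := hfa.sub measurable_const
  have hhi : Integrable h μ := hfi.abs.sub (integrable_const _)
  have hset : {x | t < mavg T f N x} = {x | 0 < bmax T h N x} := by
    ext x
    simp only [Set.mem_ofPred_eq, mavg, bmax, Finset.lt_sup'_iff]
    refine exists_congr fun n => and_congr_right fun _ => ?_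
    have : birkhoffSum T h n x = birkhoffSum T (fun y => |f y|) n x - n * t := by
      simp [birkhoffSum, hh, Finset.sum_sub_distrib]
    rw [this]
    rcases Nat.eq_zero_or_pos n with rfl | hn
    · simp [ht.le]
    · have hn' : (0 : ℝ) < n := by exact_mod_cast hn
      rw [sub_pos, inv_mul_eq_div, lt_div_iff₀ hn', mul_comm]
  have hmax := maximal_ergodic hT hhm hhi N
  rw [← hset] at hmax
  set A := {x | t < mavg T f N x} with hA
  have hAm : MeasurableSet A := measurableSet_lt measurable_const (measurable_mavg hT.measurable hf N)
  set B := {x | t < 2 * |f x|} with hB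
  have hBm : MeasurableSet B := measurableSet_lt measurable_const (hfa.const_mul 2)
  have i1 : ∫ x in A, h x ∂μ = ∫ x in A, |f x| ∂μ - μ.real A * t := by
    refine (integral_sub hfi.abs.restrict (integrable_const _)).trans ?_
    simp
  have i2 : ∫ x in A, |f x| ∂μ ≤ ∫ x in B, |f x| ∂μ + μ.real A * (t / 2) := by
    have : μ.real A * (t/2) = ∫ x, A.indicator (fun _ => t / 2) x ∂μ := by
      rw [integral_indicator hAm]; simp
    rw [this, ← integral_indicator hAm, ← integral_indicator hBm, ← integral_add
      (hfi.abs.indicator hBm) ((integrable_const _).indicator hAm)]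
    refine integral_mono (hfi.abs.indicator hAm)
      ((hfi.abs.indicator hBm).add ((integrable_const _).indicator hAm)) fun x => ?_
    simp only [Set.indicator_apply]
    have := abs_nonneg (f x)
    by_cases h1 : x ∈ A <;> by_cases h2 : x ∈ B
    · simp only [h1, h2, if_true]; linarith
    · simp only [h1, h2, if_true, if_false]
      simp only [hB, Set.mem_ofPred_eq, not_lt] at h2
      linarith
    · simp only [h1, h2, if_true, if_false]; linarith
    · simp [h1, h2]
  have i3 : μ.real A * t ≤ 2 * ∫ x in B, |f x| ∂μ := by linarith
  rw [withDensity_apply _ hBm, ← ofReal_integral_eq_lintegral_ofReal hfi.abs.restrict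
    (Eventually.of_forall fun _ => abs_nonneg _), ← ofReal_measureReal, ← ENNReal.ofReal_mul
    measureReal_nonneg]
  have : (2 : ℝ≥0∞) = ENNReal.ofReal 2 := by simp
  rw [this, ← ENNReal.ofReal_mul (by norm_num)]
  exact ENNReal.ofReal_le_ofReal i3

lemma mavg_strong {X : Type} [MeasurableSpace X] {μ : Measure X} [IsFiniteMeasure μ] {T : X → X}
    (hT : MeasurePreserving T μ μ) {f : X → ℝ} (hf : Measurable f) (hfi : Integrable f μ)
    (N : ℕ) {q : ℝ} (hq : 1 < q) :
    ∫⁻ x, ENNReal.ofReal (mavg T f N x ^ q) ∂μ ≤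
      ENNReal.ofReal (q / (q - 1) * 2 ^ q) * ∫⁻ x, ENNReal.ofReal (|f x| ^ q) ∂μ := by
  have hq1 : 0 < q - 1 := by linarith
  have hfa : Measurable fun x => |f x| := measurable_norm.comp hf
  set ν := μ.withDensity fun x => ENNReal.ofReal |f x| with hν
  rw [lintegral_rpow_eq_lintegral_meas_lt_mul μ (Eventually.of_forall fun x => mavg_nonneg _ _ _ _)
    (measurable_mavg hT.measurable hf N).aemeasurable (by linarith)]
  have key := lintegral_rpow_eq_lintegral_meas_lt_mul ν (f := fun x => 2 * |f x|)
    (Eventually.of_forall fun x => by positivity) (hfa.const_mul 2).aemeasurable hq1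
  have step : ∫⁻ t in Set.Ioi 0, μ {a | t < mavg T f N a} * ENNReal.ofReal (t ^ (q - 1)) ≤
      2 * ∫⁻ t in Set.Ioi 0, ν {a | t < 2 * |f a|} * ENNReal.ofReal (t ^ (q - 1 - 1)) := by
    rw [← lintegral_const_mul' _ _ (by simp)]
    refine setLIntegral_mono' measurableSet_Ioi fun t ht => ?_
    have ht' : 0 < t := ht
    have : t ^ (q - 1) = t * t ^ (q - 1 - 1) := by
      rw [Real.rpow_sub_one ht'.ne' (q - 1)]; field_simp
    rw [this, ENNReal.ofReal_mul ht'.le, ← mul_assoc, ← mul_assoc]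
    exact mul_le_mul' (mavg_weak hT hf hfi N ht') le_rfl
  have k2 : ∫⁻ x, ENNReal.ofReal ((2 * |f x|) ^ (q - 1)) ∂ν =
      ENNReal.ofReal (2 ^ (q - 1)) * ∫⁻ x, ENNReal.ofReal (|f x| ^ q) ∂μ := by
    rw [hν, lintegral_withDensity_eq_lintegral_mul _ hfa.ennreal_ofReal
      (((hfa.const_mul 2).pow_const _).ennreal_ofReal), ← lintegral_const_mul' _ _ (by simp)]
    refine lintegral_congr fun x => ?_
    simp only [Pi.mul_apply]
    rw [← ENNReal.ofReal_mul (abs_nonneg _), ← ENNReal.ofReal_mul (by positivity)]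
    congr 1
    rw [Real.mul_rpow (by norm_num) (abs_nonneg _)]
    rcases eq_or_ne (|f x|) 0 with h0 | h0
    · rw [h0, Real.zero_rpow (by linarith : q ≠ 0)]; simp
    · rw [Real.rpow_sub_one h0]; field_simp
  rw [k2] at key
  set I := ∫⁻ t in Set.Ioi 0, ν {a | t < 2 * |f a|} * ENNReal.ofReal (t ^ (q - 1 - 1))
  set J := ∫⁻ x, ENNReal.ofReal (|f x| ^ q) ∂μ
  calc _ ≤ ENNReal.ofReal q * (2 * I) := by gcongr
    _ = ENNReal.ofReal (q / (q - 1) * 2) * (ENNReal.ofReal (q - 1) * I) := by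
        rw [← mul_assoc, ← mul_assoc, ← ENNReal.ofReal_mul (by positivity)]
        congr 1
        rw [show (2 : ℝ≥0∞) = ENNReal.ofReal 2 by simp, ← ENNReal.ofReal_mul (by linarith)]
        congr 1; field_simp
    _ = ENNReal.ofReal (q / (q - 1) * 2 ^ q) * J := by
        rw [← key, ← mul_assoc, ← ENNReal.ofReal_mul (by positivity)]
        congr 2
        rw [Real.rpow_sub_one (by norm_num)]; ring
    _ ≤ _ := le_rfl

lemma mavg_eLpNorm {X : Type} [MeasurableSpace X] {μ : Measure X} [IsFiniteMeasure μ] {T : X → X}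
    (hT : MeasurePreserving T μ μ) {f : X → ℝ} (hf : Measurable f) 
    (N : ℕ) {p : ℝ≥0∞} (hp : 1 < p) (hp' : p ≠ ∞) (hfi : MemLp f p μ) :
    eLpNorm (mavg T f N) p μ ≤
      ENNReal.ofReal (p.toReal / (p.toReal - 1) * 2 ^ p.toReal) ^ (1 / p.toReal) * eLpNorm f p μ := by
  have hq : 1 < p.toReal := by
    rw [← ENNReal.toReal_one]; exact (ENNReal.toReal_lt_toReal (by simp) hp').2 hp
  have hp0 : p ≠ 0 := (zero_lt_one.trans hp).ne'
  rw [eLpNorm_eq_lintegral_rpow_enorm_toReal hp0 hp', eLpNorm_eq_lintegral_rpow_enorm_toReal hp0 hp',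
    ← ENNReal.mul_rpow_of_nonneg _ _ (by positivity)]
  refine ENNReal.rpow_le_rpow ?_ (by positivity)
  have := mavg_strong hT hf (hfi.integrable hp.le) N hq
  convert this using 4 with x x
  · rw [Real.enorm_eq_ofReal_abs, abs_of_nonneg (mavg_nonneg _ _ _ _),
      ENNReal.ofReal_rpow_of_nonneg (mavg_nonneg _ _ _ _) (by linarith)]
  · rw [Real.enorm_eq_ofReal_abs, ENNReal.ofReal_rpow_of_nonneg (abs_nonneg _) (by linarith)]

/-! ### Pointwise and mean ergodic theorems -/

lemma invariants_le {X : Type} [m : MeasurableSpace X] (T : X → X) : invariants T ≤ m :=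
  fun _ hs => hs.1

lemma birkhoff_condExp {X : Type} [MeasurableSpace X] {μ : Measure X} [IsProbabilityMeasure μ]
    {T : X → X} (hT : MeasurePreserving T μ μ) {f : X → ℝ} (hf : Measurable f)
    (hfi : Integrable f μ) :
    ∀ᵐ x ∂μ, Tendsto (fun n : ℕ => (n : ℝ)⁻¹ * birkhoffSum T f n x) atTop
      (𝓝 ((μ[f | invariants T]) x)) := by
  have hcm : Measurable[invariants T] (μ[f | invariants T]) :=
    (stronglyMeasurable_condExp (m := invariants T)).measurable
  refine birkhoff_ae hT hf (hcm.mono (invariants_le T) le_rfl) hfi integrable_condExp ?_ ?_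
  · intro x
    have h1 : T ⁻¹' ((μ[f | invariants T]) ⁻¹' {(μ[f | invariants T]) x}) =
        (μ[f | invariants T]) ⁻¹' {(μ[f | invariants T]) x} :=
      (hcm (measurableSet_singleton _)).2
    have h2 : x ∈ T ⁻¹' ((μ[f | invariants T]) ⁻¹' {(μ[f | invariants T]) x}) := by
      rw [h1]; simp
    simpa using h2
  · intro s hs hs'
    exact (setIntegral_condExp (invariants_le T) hfi (s := s) ⟨hs, hs'⟩).symm

/-- Cesàro averages of the Koopman operator on `Lp`. -/
def avgLp {X : Type} [MeasurableSpace X] {μ : Measure X} {p : ℝ≥0∞} [Fact (1 ≤ p)] {T : X → X}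
    (hT : MeasurePreserving T μ μ) (n : ℕ) (f : Lp ℝ p μ) : Lp ℝ p μ :=
  (n : ℝ)⁻¹ • ∑ k ∈ Finset.range n, Lp.compMeasurePreserving T^[k] (hT.iterate k) f

lemma coe_avgLp {X : Type} [MeasurableSpace X] {μ : Measure X} {p : ℝ≥0∞} [Fact (1 ≤ p)]
    {T : X → X} (hT : MeasurePreserving T μ μ) (n : ℕ) (f : Lp ℝ p μ) :
    avgLp hT n f =ᵐ[μ] (n : ℝ)⁻¹ • ∑ k ∈ Finset.range n, (fun x => f (T^[k] x)) := by
  unfold avgLp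
  refine (Lp.coeFn_smul _ _).trans ?_
  have h1 := Lp.coeFn_finsetSum (Finset.range n)
    (fun k => Lp.compMeasurePreserving T^[k] (hT.iterate k) f)
  have h2 : ∀ᵐ x ∂μ, ∀ k, Lp.compMeasurePreserving T^[k] (hT.iterate k) f x = f (T^[k] x) :=
    ae_all_iff.2 fun k => Lp.coeFn_compMeasurePreserving f (hT.iterate k)
  filter_upwards [h1, h2] with x hx1 hx2
  rw [Pi.smul_apply, hx1, Pi.smul_apply, Finset.sum_apply, Finset.sum_apply]
  simp only [hx2]

/-- the conditional expectation in `Lp` -/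
def ceLp {X : Type} [MeasurableSpace X] (μ : Measure X) [IsProbabilityMeasure μ]
    {p : ℝ≥0∞} [hp : Fact (1 ≤ p)] (T : X → X) (f : Lp ℝ p μ) : Lp ℝ p μ :=
  ((Lp.memLp f).condExp (m := invariants T) hp.out).toLp _

lemma coe_ceLp {X : Type} [MeasurableSpace X] (μ : Measure X) [IsProbabilityMeasure μ]
    {p : ℝ≥0∞} [hp : Fact (1 ≤ p)] (T : X → X) (f : Lp ℝ p μ) :
    ceLp μ T f =ᵐ[μ] μ[(f : X → ℝ) | invariants T] := MemLp.coeFn_toLp _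

lemma birkhoff_Lp_ae {X : Type} [MeasurableSpace X] {μ : Measure X} [IsProbabilityMeasure μ]
    {p : ℝ≥0∞} [hp : Fact (1 ≤ p)] {T : X → X} (hT : MeasurePreserving T μ μ) (f : Lp ℝ p μ) :
    ∀ᵐ x ∂μ, Tendsto (fun n : ℕ => (n : ℝ)⁻¹ * birkhoffSum T f n x) atTop
      (𝓝 (ceLp μ T f x)) := by
  filter_upwards [coe_ceLp μ T f, birkhoff_condExp hT (Lp.stronglyMeasurable f).measurable
    ((Lp.memLp f).integrable hp.out)] with x h1 h2
  rwa [h1]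

lemma mean_ergodic {X : Type} [MeasurableSpace X] {μ : Measure X} [IsProbabilityMeasure μ]
    {p : ℝ≥0∞} [hp : Fact (1 ≤ p)] (hp' : p ≠ ∞) {T : X → X} (hT : MeasurePreserving T μ μ)
    (f : Lp ℝ p μ) :
    Tendsto (fun n => avgLp hT n f) atTop (𝓝 (ceLp μ T f)) := by
  rw [Lp.tendsto_Lp_iff_tendsto_eLpNorm']
  have hfm := (Lp.stronglyMeasurable f).measurable
  have hm : ∀ k, AEStronglyMeasurable (fun x => f (T^[k] x)) μ := fun k =>
    (hfm.comp (hT.measurable.iterate k)).aestronglyMeasurable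
  have hui : UniformIntegrable (fun k x => f (T^[k] x)) p μ := by
    refine MemLp.uniformIntegrable_of_identDistrib (j := 0) hp.out hp' (Lp.memLp f) fun k => ?_
    refine ⟨(hm k).aemeasurable, (hm 0).aemeasurable, ?_⟩
    have := Measure.map_map (μ := μ) hfm (hT.measurable.iterate k)
    rw [(hT.iterate k).map_eq] at this
    exact this.symm
  have := tendsto_Lp_finite_of_tendsto_ae hp.out hp'
    (f := fun (n : ℕ) => (n : ℝ)⁻¹ • ∑ k ∈ Finset.range n, (fun x => f (T^[k] x)))
    (g := ceLp μ T f)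
    (fun n => (Finset.aestronglyMeasurable_sum _ fun i _ => hm i).const_smul _) (Lp.memLp _)
    (uniformIntegrable_average hp.out hui).unifIntegrable ?_
  · refine this.congr fun n => eLpNorm_congr_ae ?_
    exact (coe_avgLp hT n f).symm.sub EventuallyEq.rfl
  · filter_upwards [birkhoff_Lp_ae hT f] with x hx
    refine hx.congr fun n => ?_
    simp [birkhoffSum]

/-! ### Tensor products -/

lemma ptp_bound {X : Type} [MeasurableSpace X] {μ : Measure X} {d : ℕ} {p : Fin d → ℝ≥0∞}
    [∀ i, Fact (1 ≤ p i)] {E : Type} [NormedAddCommGroup E] [NormedSpace ℝ E] [CompleteSpace E]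
    {tp : ContinuousMultilinearMap ℝ (fun i : Fin d => Lp ℝ (p i) μ) E}
    (hE : IsPTP μ p E tp) {F : Type} [NormedAddCommGroup F] [NormedSpace ℝ F] [CompleteSpace F]
    (L : E →L[ℝ] F) {C : ℝ} (hC : 0 ≤ C) (h : ∀ f, ‖L (tp f)‖ ≤ C * ∏ i, ‖f i‖) : ‖L‖ ≤ C := by
  obtain ⟨L', hL', hn⟩ := hE.lift F (L.compContinuousMultilinearMap tp)
  have : L' = L := by
    refine ContinuousLinearMap.ext_on hE.denseSpan ?_
    rintro _ ⟨f, rfl⟩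
    exact hL' f
  rw [← this, hn]
  exact ContinuousMultilinearMap.opNorm_le_bound hC h

lemma tendsto_eval_pi {d : ℕ} (i : Fin d) :
    Tendsto (fun n : Fin d → ℕ => n i) atTop atTop :=
  tendsto_atTop_atTop.2 fun b => ⟨fun _ => b, fun _ h => h i⟩

lemma tendsto_closed {ι E F : Type} [NormedAddCommGroup E] [NormedSpace ℝ E]
    [NormedAddCommGroup F] [NormedSpace ℝ F] {l : Filter ι} (u : ι → E →L[ℝ] F) (P : E →L[ℝ] F)
    {C : ℝ} (hu : ∀ i, ‖u i‖ ≤ C) (s : Submodule ℝ E) (hs : Dense (s : Set E))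
    (h : ∀ g ∈ s, Tendsto (fun i => u i g) l (𝓝 (P g))) (f : E) :
    Tendsto (fun i => u i f) l (𝓝 (P f)) := by
  rw [Metric.tendsto_nhds]
  intro ε hε
  set K := |C| + ‖P‖ + 1 with hK
  have hKpos : 0 < K := by positivity
  obtain ⟨g, hg, hfg⟩ := Metric.dense_iff.1 hs f (ε / 2 / K) (by positivity)
  rw [Metric.mem_ball, dist_comm, dist_eq_norm] at hg
  filter_upwards [(Metric.tendsto_nhds.1 (h g hfg)) (ε / 2) (by positivity)] with i hi
  rw [dist_eq_norm] at hi ⊢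
  have e : u i f - P f = u i (f - g) + (u i g - P g) - P (f - g) := by
    simp only [map_sub]; abel
  rw [e]
  have h1 : ‖u i (f - g)‖ ≤ |C| * ‖f - g‖ :=
    (u i).le_of_opNorm_le ((hu i).trans (le_abs_self C)) _
  have h2 : ‖P (f - g)‖ ≤ ‖P‖ * ‖f - g‖ := P.le_opNorm _
  have h3 : ‖f - g‖ * K < ε / 2 := (lt_div_iff₀ hKpos).1 hg
  have h4 := norm_sub_le (u i (f - g) + (u i g - P g)) (P (f - g))
  have h5 := norm_add_le (u i (f - g)) (u i g - P g)
  nlinarith [norm_nonneg (f - g)]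

/-- Banach principle. -/
lemma banach_principle {X : Type} [MeasurableSpace X] {μ : Measure X} [IsProbabilityMeasure μ]
    {ι E : Type} [Countable ι] [NormedAddCommGroup E] [NormedSpace ℝ E] {l : Filter ι}
    {r : ℝ≥0∞} [hr : Fact (1 ≤ r)]
    (u : ι → E →L[ℝ] Lp ℝ r μ) (P : E →L[ℝ] Lp ℝ r μ) {C : ℝ}
    (hu : ∀ g : E, ∀ S : Finset ι, ∫⁻ x, ⨆ i ∈ S, ‖u i g x‖ₑ ∂μ ≤ ENNReal.ofReal (C * ‖g‖))
    (s : Submodule ℝ E) (hs : Dense (s : Set E))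
    (h : ∀ g ∈ s, ∀ᵐ x ∂μ, Tendsto (fun i => u i g x) l (𝓝 (P g x))) (f : E) :
    ∀ᵐ x ∂μ, Tendsto (fun i => u i f x) l (𝓝 (P f x)) := by
  have hmeas : ∀ i g, Measurable fun x => ‖u i g x‖ₑ := fun i g =>
    (Lp.stronglyMeasurable (u i g)).enorm
  have hsup : ∀ g : E, ∫⁻ x, ⨆ i, ‖u i g x‖ₑ ∂μ ≤ ENNReal.ofReal (C * ‖g‖) := by
    intro g
    have e : ∀ x, ⨆ i, ‖u i g x‖ₑ = ⨆ S : Finset ι, ⨆ i ∈ S, ‖u i g x‖ₑ := fun x =>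
      iSup_eq_iSup_finset _
    simp_rw [e]
    rw [lintegral_iSup_directed]
    · exact iSup_le (hu g)
    · intro S
      exact (Measurable.iSup fun i => Measurable.iSup fun _ => hmeas i g).aemeasurable
    · intro S S'
      classical
      refine ⟨S ∪ S', fun x => ?_, fun x => ?_⟩
      · exact biSup_mono fun i hi => Finset.mem_union_left _ hi
      · exact biSup_mono fun i hi => Finset.mem_union_right _ hi
  have hP : ∀ g : E, ∫⁻ x, ‖P g x‖ₑ ∂μ ≤ ENNReal.ofReal (‖P‖ * ‖g‖) := by
    intro g
    rw [← eLpNorm_one_eq_lintegral_enorm]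
    refine (eLpNorm_le_eLpNorm_of_exponent_le hr.out (Lp.aestronglyMeasurable _)).trans ?_
    rw [← Lp.enorm_def, ← ofReal_norm]
    exact ENNReal.ofReal_le_ofReal (P.le_opNorm g)
  have hj : ∀ j : ℕ, ∃ g ∈ s, ‖f - g‖ < (1 / 2) ^ j := by
    intro j
    obtain ⟨g, hg, hfg⟩ := Metric.dense_iff.1 hs f ((1 / 2) ^ j) (by positivity)
    rw [Metric.mem_ball, dist_comm, dist_eq_norm] at hg
    exact ⟨g, hfg, hg⟩
  choose g hgs hg using hj
  set M : ℕ → X → ℝ≥0∞ := fun j x => (⨆ i, ‖u i (f - g j) x‖ₑ) + ‖P (f - g j) x‖ₑ with hM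
  have hMm : ∀ j, Measurable (M j) := fun j =>
    (Measurable.iSup fun i => hmeas i _).add (Lp.stronglyMeasurable _).enorm
  have hMi : ∀ j, ∫⁻ x, M j x ∂μ ≤ ENNReal.ofReal ((|C| + ‖P‖) * (1 / 2) ^ j) := by
    intro j
    rw [hM, lintegral_add_left (Measurable.iSup fun i => hmeas i _)]
    refine (add_le_add (hsup _) (hP _)).trans ?_
    refine (add_le_add (ENNReal.ofReal_le_ofReal (q := |C| * (1/2)^j) ?_)
      (ENNReal.ofReal_le_ofReal (q := ‖P‖ * (1/2)^j) ?_)).trans ?_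
    · have := (hg j).le
      exact (mul_le_mul_of_nonneg_right (le_abs_self C) (norm_nonneg _)).trans (by gcongr)
    · have := (hg j).le
      gcongr
    · rw [← ENNReal.ofReal_add (by positivity) (by positivity), add_mul]
  have hfin : ∫⁻ x, ∑' j, M j x ∂μ ≠ ∞ := by
    rw [lintegral_tsum fun j => (hMm j).aemeasurable]
    refine ne_top_of_le_ne_top ?_ (ENNReal.tsum_le_tsum hMi)
    have hsm : Summable fun j : ℕ => (|C| + ‖P‖) * (1 / 2 : ℝ) ^ j :=
      summable_geometric_two.mul_left _
    rw [← ENNReal.ofReal_tsum_of_nonneg (fun j => by positivity) hsm]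
    exact ENNReal.ofReal_ne_top
  have hae := ae_lt_top (Measurable.tsum hMm) hfin
  have hconv : ∀ᵐ x ∂μ, ∀ j, Tendsto (fun i => u i (g j) x) l (𝓝 (P (g j) x)) :=
    ae_all_iff.2 fun j => h _ (hgs j)
  have hsubu : ∀ᵐ x ∂μ, ∀ i j, u i (f - g j) x = u i f x - u i (g j) x := by
    refine ae_all_iff.2 fun i => ae_all_iff.2 fun j => ?_
    rw [map_sub]
    exact Lp.coeFn_sub _ _
  have hsubP : ∀ᵐ x ∂μ, ∀ j, P (f - g j) x = P f x - P (g j) x := by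
    refine ae_all_iff.2 fun j => ?_
    rw [map_sub]
    exact Lp.coeFn_sub _ _
  filter_upwards [hae, hconv, hsubu, hsubP] with x h1 h2 h3 h4
  have h5 := ENNReal.tendsto_atTop_zero_of_tsum_ne_top h1.ne
  rw [EMetric.tendsto_nhds]
  intro ε hε
  have hε2 : 0 < ε / 2 := ENNReal.half_pos hε.ne'
  obtain ⟨j, hj⟩ := (h5.eventually (gt_mem_nhds hε2)).exists
  filter_upwards [EMetric.tendsto_nhds.1 (h2 j) (ε / 2) hε2] with i hi
  rw [edist_eq_enorm_sub] at hi ⊢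
  have e : u i f x - P f x = (u i (f - g j) x - P (f - g j) x) + (u i (g j) x - P (g j) x) := by
    rw [h3, h4]; ring
  rw [e]
  have b1 : ‖u i (f - g j) x - P (f - g j) x‖ₑ ≤ M j x :=
    enorm_sub_le.trans (add_le_add (le_iSup (fun i => ‖u i (f - g j) x‖ₑ) i) le_rfl)
  calc _ ≤ ‖u i (f - g j) x - P (f - g j) x‖ₑ + ‖u i (g j) x - P (g j) x‖ₑ := enorm_add_le _ _
    _ < ε / 2 + ε / 2 := ENNReal.add_lt_add (b1.trans_lt hj) hi
    _ = ε := ENNReal.add_halves ε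

lemma eLpNorm_prod_le' {ι X : Type} [MeasurableSpace X] {μ : Measure X} {f : ι → X → ℝ}
    {p : ι → ℝ≥0∞} (s : Finset ι) [IsProbabilityMeasure μ]
    (hf : ∀ i, AEStronglyMeasurable (f i) μ) :
    eLpNorm (∏ i ∈ s, f i) (∑ i ∈ s, (p i)⁻¹)⁻¹ μ ≤ ∏ i ∈ s, eLpNorm (f i) (p i) μ := by
  induction s using Finset.cons_induction with
  | empty =>
    simp only [Finset.prod_empty, Finset.sum_empty, ENNReal.inv_zero, eLpNorm_exponent_top]
    refine (eLpNormEssSup_le_of_ae_enorm_bound (C := 1) (Eventually.of_forall fun x => ?_))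
    simp
  | cons i s hi ih =>
    rw [Finset.prod_cons, Finset.prod_cons]
    have := eLpNorm_smul_le_mul_eLpNorm (p := p i) (q := (∑ i ∈ s, (p i)⁻¹)⁻¹)
      (r := (∑ j ∈ Finset.cons i s hi, (p j)⁻¹)⁻¹) (Finset.aestronglyMeasurable_prod s
      fun j _ => hf j) (hf i) (hpqr := ⟨by simp⟩)
    exact this.trans (mul_le_mul' le_rfl ih)

section main

variable {X : Type} [MeasurableSpace X] {μ : Measure X} {d : ℕ} {r p : ℝ≥0∞}
  [Fact (1 ≤ r)] [Fact (1 ≤ p)] {T : Fin d → X → X}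
  {E : Type} [NormedAddCommGroup E] [NormedSpace ℝ E]

/-- The averaged operators. -/
def uu (D : E →L[ℝ] Lp ℝ r μ) (W : (Fin d → ℕ) → E →L[ℝ] E) (n : Fin d → ℕ) :
    E →L[ℝ] Lp ℝ r μ :=
  (∏ i, (n i : ℝ))⁻¹ • ∑ k ∈ Fintype.piFinset (fun i => Finset.range (n i)), D ∘L W k

lemma uu_apply (D : E →L[ℝ] Lp ℝ r μ) (W : (Fin d → ℕ) → E →L[ℝ] E) (n : Fin d → ℕ) (f : E) :
    uu D W n f = (∏ i, (n i : ℝ))⁻¹ •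
      ∑ k ∈ Fintype.piFinset (fun i => Finset.range (n i)), D (W k f) := by
  simp [uu]

lemma coe_uu (D : E →L[ℝ] Lp ℝ r μ) (W : (Fin d → ℕ) → E →L[ℝ] E) (f : E) :
    ∀ᵐ x ∂μ, ∀ n : Fin d → ℕ, uu D W n f x = (∏ i, (n i : ℝ))⁻¹ *
      ∑ k ∈ Fintype.piFinset (fun i => Finset.range (n i)), (D (W k f) : X → ℝ) x := by
  refine ae_all_iff.2 fun n => ?_
  rw [uu_apply]
  filter_upwards [Lp.coeFn_smul (∏ i, (n i : ℝ))⁻¹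
      (∑ k ∈ Fintype.piFinset (fun i => Finset.range (n i)), D (W k f)),
    Lp.coeFn_finsetSum (Fintype.piFinset (fun i => Finset.range (n i)))
      (fun k => D (W k f))] with x h1 h2
  rw [h1, Pi.smul_apply, h2]
  simp

variable [CompleteSpace E] {tp : ContinuousMultilinearMap ℝ (fun _ : Fin d => Lp ℝ p μ) E}
  {D : E →L[ℝ] Lp ℝ r μ} {W : (Fin d → ℕ) → E →L[ℝ] E}

lemma W_tp (hT : ∀ i, MeasurePreserving (T i) μ μ)
    (hW : ∀ k, IsTKoop μ (fun _ : Fin d => p) tp T k (W k)) (k : Fin d → ℕ)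
    (f : Fin d → Lp ℝ p μ) :
    W k (tp f) = tp (fun i => Lp.compMeasurePreserving (T i)^[k i] ((hT i).iterate (k i)) (f i)) :=
  hW k f _ fun i => Lp.coeFn_compMeasurePreserving (f i) ((hT i).iterate (k i))

lemma Winv_tp [IsProbabilityMeasure μ] {Winv : E →L[ℝ] E}
    (hWinv : IsTCondexpInv μ (fun _ : Fin d => p) tp T Winv)
    (f : Fin d → Lp ℝ p μ) :
    Winv (tp f) = tp (fun i => ceLp μ (T i) (f i)) :=
  hWinv f _ fun i => coe_ceLp μ (T i) (f i)

lemma uu_tp (hT : ∀ i, MeasurePreserving (T i) μ μ)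
    (hW : ∀ k, IsTKoop μ (fun _ : Fin d => p) tp T k (W k)) (n : Fin d → ℕ)
    (f : Fin d → Lp ℝ p μ) :
    uu D W n (tp f) = D (tp (fun i => avgLp (hT i) (n i) (f i))) := by
  unfold avgLp
  rw [tp.map_smul_univ, ContinuousMultilinearMap.map_sum_finset, uu_apply, map_smul, map_sum,
    Finset.prod_inv_distrib]
  simp only [W_tp hT hW]

lemma coe_uu_tp (hT : ∀ i, MeasurePreserving (T i) μ μ)
    (hD : IsDiag μ (fun _ : Fin d => p) r tp D)
    (hW : ∀ k, IsTKoop μ (fun _ : Fin d => p) tp T k (W k)) (f : Fin d → Lp ℝ p μ) :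
    ∀ᵐ x ∂μ, ∀ n : Fin d → ℕ, uu D W n (tp f) x =
      ∏ i, ((n i : ℝ)⁻¹ * birkhoffSum (T i) (f i) (n i) x) := by
  refine ae_all_iff.2 fun n => ?_
  rw [uu_tp hT hW]
  have h2 : ∀ᵐ x ∂μ, ∀ i, avgLp (hT i) (n i) (f i) x =
      ((n i : ℝ)⁻¹ • ∑ k ∈ Finset.range (n i), (fun x => f i ((T i)^[k] x))) x :=
    ae_all_iff.2 fun i => coe_avgLp (hT i) (n i) (f i)
  filter_upwards [hD.2 (fun i => avgLp (hT i) (n i) (f i)), h2] with x h1 h2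
  rw [h1]
  refine Finset.prod_congr rfl fun i _ => ?_
  rw [h2]
  simp [birkhoffSum]

lemma uu_norm (hT : ∀ i, MeasurePreserving (T i) μ μ)
    (hE : IsPTP μ (fun _ : Fin d => p) E tp)
    (hD : IsDiag μ (fun _ : Fin d => p) r tp D)
    (hW : ∀ k, IsTKoop μ (fun _ : Fin d => p) tp T k (W k)) (n : Fin d → ℕ) :
    ‖uu D W n‖ ≤ 1 := by
  refine ptp_bound hE _ zero_le_one fun f => ?_
  rw [uu_tp hT hW, one_mul]
  refine (D.le_opNorm _).trans ?_
  rw [hD.1, one_mul, hE.crossNorm]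
  refine Finset.prod_le_prod (fun _ _ => norm_nonneg _) fun i _ => ?_
  unfold avgLp
  rw [norm_smul]
  have h1 : ‖∑ k ∈ Finset.range (n i),
      Lp.compMeasurePreserving (T i)^[k] ((hT i).iterate k) (f i)‖ ≤ n i * ‖f i‖ := by
    refine (norm_sum_le _ _).trans ?_
    simp [Lp.norm_compMeasurePreserving]
  rw [norm_inv, RCLike.norm_natCast]
  rcases Nat.eq_zero_or_pos (n i) with h0 | h0
  · simp [h0]
  · have : (0 : ℝ) < n i := by exact_mod_cast h0
    rwa [inv_mul_le_iff₀ this]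

lemma uu_maximal [IsProbabilityMeasure μ] (hd : 1 ≤ d) (hr : r ≠ ∞) (hp : p = r * d) (hp1 : 1 < p)
    (hT : ∀ i, MeasurePreserving (T i) μ μ)
    (hE : IsPTP μ (fun _ : Fin d => p) E tp)
    (hD : IsDiag μ (fun _ : Fin d => p) r tp D)
    (hW : ∀ k, IsTKoop μ (fun _ : Fin d => p) tp T k (W k)) :
    ∃ C : ℝ, ∀ g : E, ∀ S : Finset (Fin d → ℕ),
      ∫⁻ x, ⨆ n ∈ S, ‖uu D W n g x‖ₑ ∂μ ≤ ENNReal.ofReal (C * ‖g‖) := by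
  classical
  have hp' : p ≠ ∞ := by rw [hp]; exact ENNReal.mul_ne_top hr (by simp)
  set K : ℝ≥0∞ := ENNReal.ofReal (p.toReal / (p.toReal - 1) * 2 ^ p.toReal) ^ (1 / p.toReal)
  have hK : K ≠ ∞ := ENNReal.rpow_ne_top_of_nonneg (by positivity) ENNReal.ofReal_ne_top
  refine ⟨K.toReal ^ d, fun g S => ?_⟩
  -- the vector valued operator
  set U : E →L[ℝ] Lp (S → ℝ) r μ := ∑ n : S,
    ((ContinuousLinearMap.single ℝ (fun _ : S => ℝ) n).compLpL r μ) ∘L (uu D W n.1) with hU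
  have hUcoe : ∀ g : E, ∀ᵐ x ∂μ, U g x = fun n : S => uu D W n.1 g x := by
    intro g
    have e : U g = ∑ n : S, (ContinuousLinearMap.single ℝ (fun _ : S => ℝ) n).compLpL r μ
        (uu D W n.1 g) := by simp [hU]
    rw [e]
    have h2 : ∀ᵐ x ∂μ, ∀ n : S, (ContinuousLinearMap.single ℝ (fun _ : S => ℝ) n).compLpL r μ
        (uu D W n.1 g) x = (ContinuousLinearMap.single ℝ (fun _ : S => ℝ) n) (uu D W n.1 g x) :=
      ae_all_iff.2 fun n => ContinuousLinearMap.coeFn_compLpL _ _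
    filter_upwards [Lp.coeFn_finsetSum Finset.univ (fun n : S =>
      (ContinuousLinearMap.single ℝ (fun _ : S => ℝ) n).compLpL r μ (uu D W n.1 g)), h2]
      with x h1 h2
    rw [h1]
    ext m
    simp [h2, Finset.sum_apply, Pi.single_apply]
  have hUn : ‖U‖ ≤ K.toReal ^ d := by
    refine ptp_bound hE _ (by positivity) fun f => ?_
    obtain ⟨N, hN⟩ : ∃ N : ℕ, ∀ n ∈ S, ∀ i, n i ≤ N :=
      ⟨S.sup fun n => Finset.univ.sup n, fun n hn i =>
        (Finset.le_sup (f := n) (Finset.mem_univ i)).trans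
          (Finset.le_sup (f := fun n : Fin d → ℕ => Finset.univ.sup n) hn)⟩
    have hfm : ∀ i, Measurable (f i : X → ℝ) := fun i => (Lp.stronglyMeasurable (f i)).measurable
    have hb : ∀ᵐ x ∂μ, ‖U (tp f) x‖ ≤ ‖(∏ i, mavg (T i) (f i) N) x‖ := by
      filter_upwards [hUcoe (tp f), coe_uu_tp hT hD hW f] with x h1 h2
      rw [h1, pi_norm_le_iff_of_nonneg (norm_nonneg _)]
      rintro ⟨n, hn⟩
      simp only
      rw [h2, Finset.prod_apply, norm_prod, norm_prod]
      refine Finset.prod_le_prod (fun _ _ => norm_nonneg _) fun i _ => ?_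
      rw [Real.norm_of_nonneg (mavg_nonneg _ _ _ _)]
      exact avg_le_mavg _ _ _ _ (hN n hn i)
    have hexp : (∑ _i : Fin d, p⁻¹)⁻¹ = r := by
      have hd0 : (d : ℝ≥0∞) ≠ 0 := by simp; omega
      simp only [Finset.sum_const, Finset.card_univ, Fintype.card_fin, nsmul_eq_mul]
      rw [hp, ENNReal.mul_inv (Or.inr (by simp)) (Or.inr hd0), mul_left_comm,
        ENNReal.mul_inv_cancel hd0 (by simp), mul_one, inv_inv]
    have h1 : eLpNorm (U (tp f)) r μ ≤ ∏ i, (K * eLpNorm (f i) p μ) := by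
      refine (eLpNorm_mono_ae hb).trans ?_
      have := eLpNorm_prod_le' (μ := μ) (f := fun i => mavg (T i) (f i) N) (p := fun _ => p)
        Finset.univ (fun i => (measurable_mavg (hT i).measurable (hfm i) N).aestronglyMeasurable)
      rw [hexp] at this
      refine this.trans (Finset.prod_le_prod' fun i _ => ?_)
      exact mavg_eLpNorm (hT i) (hfm i) N hp1 hp' (Lp.memLp _)
    rw [Lp.norm_def]
    refine (ENNReal.toReal_mono ?_ h1).trans ?_
    · exact ENNReal.prod_ne_top fun i _ => ENNReal.mul_ne_top hK (Lp.eLpNorm_ne_top _)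
    · rw [ENNReal.toReal_prod]
      simp only [ENNReal.toReal_mul, Finset.prod_mul_distrib, Finset.prod_const, Finset.card_univ,
        Fintype.card_fin, Lp.norm_def]
      exact le_rfl
  calc ∫⁻ x, ⨆ n ∈ S, ‖uu D W n g x‖ₑ ∂μ ≤ ∫⁻ x, ‖U g x‖ₑ ∂μ := by
        refine lintegral_mono_ae ?_
        filter_upwards [hUcoe g] with x hx
        refine iSup₂_le fun n hn => ?_
        rw [hx, ← ofReal_norm, ← ofReal_norm]
        exact ENNReal.ofReal_le_ofReal (norm_le_pi_norm (fun n : S => uu D W n.1 g x) ⟨n, hn⟩)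
    _ ≤ eLpNorm (U g) r μ := by
        rw [← eLpNorm_one_eq_lintegral_enorm]
        exact eLpNorm_le_eLpNorm_of_exponent_le Fact.out (Lp.aestronglyMeasurable _)
    _ = ENNReal.ofReal ‖U g‖ := by rw [ofReal_norm, Lp.enorm_def]
    _ ≤ _ := ENNReal.ofReal_le_ofReal (U.le_of_opNorm_le hUn g)

end main

lemma surj_one {X : Type} [MeasurableSpace X] {μ : Measure X} {p : ℝ≥0∞} [Fact (1 ≤ p)]
    {E : Type} [NormedAddCommGroup E] [NormedSpace ℝ E] [CompleteSpace E]
    {tp : ContinuousMultilinearMap ℝ (fun _ : Fin 1 => Lp ℝ p μ) E}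
    (hE : IsPTP μ (fun _ : Fin 1 => p) E tp) (f : E) : ∃ g, tp g = f := by
  set φ : Lp ℝ p μ →L[ℝ] E := tp.toContinuousLinearMap 0 0 with hφ
  have hφa : ∀ g, φ g = tp (fun _ => g) := by
    intro g
    change tp (Function.update 0 0 g) = _
    congr 1
    ext1 i
    rw [Subsingleton.elim i 0, Function.update_self]
  have hiso : Isometry φ := by
    refine AddMonoidHomClass.isometry_of_norm φ fun g => ?_
    rw [hφa, hE.crossNorm]; simp
  have hcl : IsClosed (LinearMap.range φ.toLinearMap : Set E) := by
    have := hiso.isClosedEmbedding.isClosed_range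
    exact this
  have hle : Submodule.span ℝ (Set.range fun f : Fin 1 → Lp ℝ p μ => tp f) ≤
      LinearMap.range φ.toLinearMap := by
    rw [Submodule.span_le]
    rintro _ ⟨g, rfl⟩
    refine ⟨g 0, ?_⟩
    change φ (g 0) = tp g
    rw [hφa]
    congr 1
    ext1 i
    rw [Subsingleton.elim i 0]
  have hmem : f ∈ (LinearMap.range φ.toLinearMap : Set E) :=
    hcl.closure_subset_iff.2 hle (hE.denseSpan f)
  obtain ⟨g, hg⟩ := hmem
  exact ⟨fun _ => g, by rw [← hφa]; exact hg⟩

/-- Proposition 3, multivariate ergodic theorem: for `p = rd` and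
`f ∈ L_{p,π}(μ^d)`, the averages `(n_1⋯n_d)^{-1} Σ_{𝟎≤𝐤<𝐧} D_d V^𝐤 f` converge
`μ`-a.s. and in `L_r(μ)` to `D_d (E_{inv,1} ⊗_π ⋯ ⊗_π E_{inv,d}) f`
as `n_1,…,n_d → ∞`. -/
theorem statement5
    {X : Type} [MeasurableSpace X] [StandardBorelSpace X]
    (μ : Measure X) [IsProbabilityMeasure μ]
    (d : ℕ) (hd : 1 ≤ d) (r p : ℝ≥0∞) [Fact (1 ≤ r)] [Fact (1 ≤ p)]
    (hr : r ≠ ∞) (hp : p = r * d)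
    (T : Fin d → X → X) (hT : ∀ i, MeasurePreserving (T i) μ μ)
    (E : Type) [NormedAddCommGroup E] [NormedSpace ℝ E] [CompleteSpace E]
    (tp : ContinuousMultilinearMap ℝ (fun _ : Fin d => Lp ℝ p μ) E)
    (hE : IsPTP μ (fun _ : Fin d => p) E tp)
    (D : E →L[ℝ] Lp ℝ r μ) (hD : IsDiag μ (fun _ : Fin d => p) r tp D)
    (W : (Fin d → ℕ) → E →L[ℝ] E)
    (hW : ∀ k, IsTKoop μ (fun _ : Fin d => p) tp T k (W k))
    (Winv : E →L[ℝ] E) (hWinv : IsTCondexpInv μ (fun _ : Fin d => p) tp T Winv)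
    (f : E) :
    (∀ᵐ x ∂μ, Tendsto (fun n : Fin d → ℕ =>
        (∏ i, (n i : ℝ))⁻¹ *
          ∑ k ∈ Fintype.piFinset (fun i => Finset.range (n i)), (D (W k f) : X → ℝ) x)
      atTop (𝓝 ((D (Winv f) : X → ℝ) x))) ∧
    Tendsto (fun n : Fin d → ℕ =>
        (∏ i, (n i : ℝ))⁻¹ •
          ∑ k ∈ Fintype.piFinset (fun i => Finset.range (n i)), D (W k f))
      atTop (𝓝 (D (Winv f))) := by
  classical
  have hp' : p ≠ ∞ := by rw [hp]; exact ENNReal.mul_ne_top hr (by simp)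
  have hden := hE.denseSpan
  set s : Submodule ℝ E := Submodule.span ℝ (Set.range fun f : Fin d → Lp ℝ p μ => tp f) with hs
  set P : E →L[ℝ] Lp ℝ r μ := D ∘L Winv with hP
  have hmean : ∀ g ∈ s, Tendsto (fun n => uu D W n g) atTop (𝓝 (P g)) := by
    intro g hg
    induction hg using Submodule.span_induction with
    | mem x hx =>
      obtain ⟨f, rfl⟩ := hx
      simp only [uu_tp hT hW, hP, ContinuousLinearMap.comp_apply, Winv_tp hWinv]
      refine (D.continuous.tendsto _).comp ((tp.cont.tendsto _).comp ?_)
      refine tendsto_pi_nhds.2 fun i => ?_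
      exact (mean_ergodic hp' (hT i) (f i)).comp (tendsto_eval_pi i)
    | zero => simp
    | add x y _ _ hx hy => simpa using hx.add hy
    | smul a x _ hx => simpa using hx.const_smul a
  have hae : ∀ g ∈ s, ∀ᵐ x ∂μ, Tendsto (fun n => uu D W n g x) atTop (𝓝 (P g x)) := by
    intro g hg
    induction hg using Submodule.span_induction with
    | mem x hx =>
      obtain ⟨f, rfl⟩ := hx
      have h1 := coe_uu_tp hT hD hW f
      have h2 : ∀ᵐ x ∂μ, ∀ i, Tendsto (fun n : ℕ => (n : ℝ)⁻¹ * birkhoffSum (T i) (f i) n x) atTop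
          (𝓝 (ceLp μ (T i) (f i) x)) := ae_all_iff.2 fun i => birkhoff_Lp_ae (hT i) (f i)
      have h3 := hD.2 (fun i => ceLp μ (T i) (f i))
      filter_upwards [h1, h2, h3] with x h1 h2 h3
      simp only [h1, hP, ContinuousLinearMap.comp_apply, Winv_tp hWinv]
      rw [h3]
      exact tendsto_finsetProd _ fun i _ => (h2 i).comp (tendsto_eval_pi i)
    | zero =>
      filter_upwards [Lp.coeFn_zero ℝ r μ] with x hx
      simp [hx]
    | add a b _ _ ha hb =>
      have h1 : ∀ᵐ x ∂μ, ∀ n, uu D W n (a + b) x = uu D W n a x + uu D W n b x := by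
        refine ae_all_iff.2 fun n => ?_
        rw [map_add]; exact Lp.coeFn_add _ _
      have h2 : ∀ᵐ x ∂μ, P (a + b) x = P a x + P b x := by
        rw [map_add]; exact Lp.coeFn_add _ _
      filter_upwards [h1, h2, ha, hb] with x h1 h2 h3 h4
      simp only [h1, h2]
      exact h3.add h4
    | smul c a _ ha =>
      have h1 : ∀ᵐ x ∂μ, ∀ n, uu D W n (c • a) x = c * uu D W n a x := by
        refine ae_all_iff.2 fun n => ?_
        rw [map_smul]; exact Lp.coeFn_smul _ _
      have h2 : ∀ᵐ x ∂μ, P (c • a) x = c * P a x := by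
        rw [map_smul]; exact Lp.coeFn_smul _ _
      filter_upwards [h1, h2, ha] with x h1 h2 h3
      simp only [h1, h2]
      exact h3.const_mul c
  have hfin : ∀ᵐ x ∂μ, Tendsto (fun n => uu D W n f x) atTop (𝓝 (P f x)) := by
    by_cases hd1 : d = 1
    · refine hae f ?_
      subst hd1
      obtain ⟨g, rfl⟩ := surj_one hE f
      exact Submodule.subset_span ⟨_, rfl⟩
    · have hp1 : 1 < p := by
        have h2 : (2 : ℝ≥0∞) ≤ d := by exact_mod_cast (by omega : 2 ≤ d)
        rw [hp]
        calc (1 : ℝ≥0∞) < 1 * 2 := by norm_num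
          _ ≤ r * d := mul_le_mul' (Fact.out) h2
      obtain ⟨C, hC⟩ := uu_maximal hd hr hp hp1 hT hE hD hW
      exact banach_principle (uu D W) P hC s hden hae f
  constructor
  · filter_upwards [hfin, coe_uu D W f] with x h1 h2
    simp only [h2] at h1
    exact h1
  · have := tendsto_closed (uu D W) P (uu_norm hT hE hD hW) s hden hmean f
    simp only [uu_apply] at this
    exact this

end VonMises
end
end
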